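/- arXiv:1612.09427 — 2 statements merged into one kernel-verified Lean document; each statement's English description precedes it below -/
import Mathlib

section
/- Let d ≥ 3, let F ≤ Sym({1,…,d}) be primitive but not cyclic of prime order, and set 𝔾 = U(F)⁺. Then for every end ξ ∈ ∂𝒯, the subgroup 𝔾_ξ⁰ = {g ∈ 𝔾 : g(ξ) = ξ and g fixes some vertex of 𝒯} is not compact. -/
open Filter Topology
open scoped InnerProductSpace

namespace TreeHM

variable {V : Type}

/-! ### The automorphism group of a graph, with the topology of pointwise convergence -/

noncomputable instance autTopologicalSpace (T : SimpleGraph V) : TopologicalSpace (T ≃g T) :=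
  letI : TopologicalSpace V := ⊥
  TopologicalSpace.induced (fun (g : T ≃g T) (x : V) => g x) inferInstance

/-- A graph automorphism preserves the combinatorial distance. -/
theorem iso_dist_le (T : SimpleGraph V) (g : T ≃g T) (u v : V) :
    T.dist (g u) (g v) ≤ T.dist u v := by
  by_cases h : T.Reachable u v
  · obtain ⟨p, hp⟩ := h.exists_walk_length_eq_dist
    calc T.dist (g u) (g v) ≤ (p.map g.toHom).length := SimpleGraph.dist_le _
      _ = p.length := SimpleGraph.Walk.length_map _ _
      _ = T.dist u v := hp
  · rw [SimpleGraph.dist_eq_zero_of_not_reachable h,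
      SimpleGraph.dist_eq_zero_of_not_reachable]
    intro hr
    have := hr.map g.symm.toHom
    exact h (by simpa using this)

theorem iso_dist_eq (T : SimpleGraph V) (g : T ≃g T) (u v : V) :
    T.dist (g u) (g v) = T.dist u v := by
  refine le_antisymm (iso_dist_le T g u v) ?_
  have := iso_dist_le T g⁻¹ (g u) (g v)
  simpa using this

/-- The tree `T` is locally finite. -/
def LocFin (T : SimpleGraph V) : Prop := ∀ x : V, (T.neighborSet x).Finite

/-- The graph `T` is `d`-regular: every vertex has exactly `d` neighbours. -/
def Regular (T : SimpleGraph V) (d : ℕ) : Prop := ∀ x : V, (T.neighborSet x).ncard = d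

/-! ### Geodesic rays and ends -/

/-- A geodesic ray in a graph; for a tree, the ends `∂T` are the equivalence classes of
geodesic rays under the relation `RayEquiv` of sharing a common subray.  Throughout, an end
`ξ ∈ ∂T` is represented by a geodesic ray, and equality of ends is `RayEquiv`. -/
structure GeodRay (T : SimpleGraph V) : Type where
  seq : ℕ → V
  adj : ∀ n, T.Adj (seq n) (seq (n + 1))
  geodesic : ∀ m n, T.dist (seq m) (seq n) = Nat.dist m n

/-- A bi-infinite geodesic line in a graph. -/
structure GeodLine (T : SimpleGraph V) : Type where
  seq : ℤ → V
  adj : ∀ n, T.Adj (seq n) (seq (n + 1))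
  geodesic : ∀ m n, T.dist (seq m) (seq n) = (m - n).natAbs

/-- Two geodesic rays are equivalent (define the same end) iff they share a common subray. -/
def RayEquiv (T : SimpleGraph V) (r s : GeodRay T) : Prop :=
  ∃ k l : ℕ, ∀ n : ℕ, r.seq (k + n) = s.seq (l + n)

/-- The image of a geodesic ray under an automorphism. -/
def mapRay (T : SimpleGraph V) (g : T ≃g T) (r : GeodRay T) : GeodRay T where
  seq := fun n => g (r.seq n)
  adj := fun n => g.map_adj_iff.mpr (r.adj n)
  geodesic := fun m n => by rw [iso_dist_eq]; exact r.geodesic m n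

/-- `g` fixes the end represented by the ray `r`. -/
def FixesEnd (T : SimpleGraph V) (g : T ≃g T) (r : GeodRay T) : Prop :=
  RayEquiv T (mapRay T g r) r

/-- A sequence of vertices converges to the end represented by the geodesic ray `r`:
for every `m`, the vertex `r.seq m` eventually lies on the geodesic from `r.seq 0` to `y n`,
i.e. the common initial segment of `[r.seq 0, y n]` and the ray tends to infinity. -/
def TendstoEnd (T : SimpleGraph V) (y : ℕ → V) (r : GeodRay T) : Prop :=
  ∀ m : ℕ, ∀ᶠ n in atTop, T.dist (r.seq 0) (y n) = m + T.dist (r.seq m) (y n)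

/-! ### Translation length and hyperbolic automorphisms -/

/-- The translation length `|g| = min_x dist(x, g x)` of an automorphism. -/
noncomputable def transLen (T : SimpleGraph V) (g : T ≃g T) : ℕ :=
  sInf (Set.range fun x : V => T.dist x (g x))

/-- `g` is hyperbolic iff its translation length is positive. -/
def IsHyperbolic (T : SimpleGraph V) (g : T ≃g T) : Prop := 0 < transLen T g

/-- The set `Min(g)` of vertices realizing the translation length; for a hyperbolic
automorphism of a tree this is its translation axis. -/
def MinSet (T : SimpleGraph V) (g : T ≃g T) : Set V :=
  {x : V | T.dist x (g x) = transLen T g}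

/-- The ray `r` (based at the axis) represents the attracting end of `a`:
the orbit `a^n x` converges to this end. -/
def IsAttractingEnd (T : SimpleGraph V) (a : T ≃g T) (r : GeodRay T) : Prop :=
  TendstoEnd T (fun n : ℕ => (a ^ n) (r.seq 0)) r

/-! ### Half-trees and Tits' independence property -/

/-- The half-tree determined by an oriented edge `(a, b)` of a tree:  all vertices `y`
lying on the side of `a`, i.e. whose geodesic to `b` passes through `a`. -/
def EdgeSide (T : SimpleGraph V) (a b : V) : Set V :=
  {y : V | T.dist b y = T.dist a y + 1}

/-- The half-tree emanating from the base vertex `r.seq 0` of a ray `r` and containing the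
end of `r` in its boundary. -/
def RaySide (T : SimpleGraph V) (r : GeodRay T) : Set V :=
  {y : V | y = r.seq 0 ∨ T.dist (r.seq 0) y = 1 + T.dist (r.seq 1) y}

/-- Tits' independence property for a subgroup `G ≤ Aut(T)`:  for every edge `e = (a, b)`,
the pointwise stabilizer `G_e` decomposes as `G_{T₁} · G_{T₂}`, where `T₁, T₂` are the two
half-trees emanating from `e` and `G_{Tᵢ}` is the pointwise stabilizer of `Tᵢ`. -/
def TitsIndep (T : SimpleGraph V) (G : Subgroup (T ≃g T)) : Prop :=
  ∀ a b : V, T.Adj a b → ∀ g ∈ G, g a = a → g b = b →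
    ∃ g₁ ∈ G, ∃ g₂ ∈ G, g = g₁ * g₂ ∧
      (∀ y ∈ EdgeSide T a b, g₁ y = y) ∧ (∀ y ∈ EdgeSide T b a, g₂ y = y)

/-! ### Stabilizers and contraction groups -/

/-- The subgroup `G_ξ⁰ = {g ∈ G : g ξ = ξ and g fixes some vertex}`, as a subset of `G`. -/
def EndStab0 (T : SimpleGraph V) (G : Subgroup (T ≃g T)) (ξ : GeodRay T) : Set G :=
  {g : G | FixesEnd T (g : T ≃g T) ξ ∧ ∃ x : V, (g : T ≃g T) x = x}

/-- The contraction group `U⁺_α` of a sequence `α` in `G`. -/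
def ContrSeq {G : Type} [Group G] [TopologicalSpace G] (α : ℕ → G) : Set G :=
  {g : G | Tendsto (fun n : ℕ => (α n)⁻¹ * g * α n) atTop (𝓝 1)}

/-- The contraction group `U⁺_a = {g : a⁻ⁿ g aⁿ → 1}` of an element `a` of `G`. -/
def Upos {G : Type} [Group G] [TopologicalSpace G] (a : G) : Set G :=
  ContrSeq (fun n : ℕ => a ^ n)

/-- The contraction group `U⁻_a = {g : aⁿ g a⁻ⁿ → 1}` of an element `a` of `G`. -/
def Uneg {G : Type} [Group G] [TopologicalSpace G] (a : G) : Set G :=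
  ContrSeq (fun n : ℕ => (a ^ n)⁻¹)

/-! ### Unitary representations and the Howe–Moore property -/

/-- A (strongly continuous) unitary representation of a topological group `G` on a complex
inner product space `H`. -/
structure UnitaryRep (G : Type) [Group G] [TopologicalSpace G]
    (H : Type) [NormedAddCommGroup H] [InnerProductSpace ℂ H] where
  ρ : G →* (H ≃ₗᵢ[ℂ] H)
  strong_continuity : ∀ v : H, Continuous fun g : G => ρ g v

/-- The representation `π` has no nonzero `G`-invariant vector. -/
def NoInvariantVectors {G : Type} [Group G] [TopologicalSpace G]
    {H : Type} [NormedAddCommGroup H] [InnerProductSpace ℂ H]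
    (π : UnitaryRep G H) : Prop :=
  ∀ v : H, (∀ g : G, π.ρ g v = v) → v = 0

/-- The Howe–Moore property: every unitary representation without nonzero invariant vectors
has all its matrix coefficients vanishing at infinity. -/
def HasHoweMoore (G : Type) [Group G] [TopologicalSpace G] : Prop :=
  ∀ (H : Type) [NormedAddCommGroup H] [InnerProductSpace ℂ H] [CompleteSpace H]
    (π : UnitaryRep G H), NoInvariantVectors π →
      ∀ v w : H, Tendsto (fun g : G => ⟪π.ρ g v, w⟫_ℂ) (cocompact G) (𝓝 0)

/-! ### Legal colorings and the universal groups of Burger–Mozes -/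

/-- A legal coloring of a `d`-regular tree: a coloring of the (unoriented) edges by
`{1, …, d}` whose restriction to the star of each vertex is a bijection onto `{1, …, d}`.
The color of the edge `{x, y}` is recorded as `color x y` with `color x y = color y x`. -/
structure LegalColoring (T : SimpleGraph V) (d : ℕ) where
  color : V → V → Fin d
  symm : ∀ x y : V, T.Adj x y → color x y = color y x
  injOn : ∀ x : V, Set.InjOn (color x) (T.neighborSet x)
  surjOn : ∀ x : V, Set.SurjOn (color x) (T.neighborSet x) Set.univ

/-- Membership in the universal group `U(F)`: at every vertex `x` the local action of `g`
on colors is given by an element of `F`. -/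
def InUF {d : ℕ} (T : SimpleGraph V) (F : Subgroup (Equiv.Perm (Fin d)))
    (ι : LegalColoring T d) (g : T ≃g T) : Prop :=
  ∀ x : V, ∃ σ ∈ F, ∀ y : V, T.Adj x y → σ (ι.color x y) = ι.color (g x) (g y)

/-- The universal group `U(F)⁺`: the subgroup of `Aut(T)` generated by the elements of
`U(F)` fixing (pointwise) an edge of `T`. -/
def UFplus {d : ℕ} (T : SimpleGraph V) (F : Subgroup (Equiv.Perm (Fin d)))
    (ι : LegalColoring T d) : Subgroup (T ≃g T) :=
  Subgroup.closure
    {g : T ≃g T | InUF T F ι g ∧ ∃ x y : V, T.Adj x y ∧ g x = x ∧ g y = y}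

/-! ### Permutation group conditions -/

/-- `F` acts transitively on `{1, …, d}`. -/
def PermTransitive {d : ℕ} (F : Subgroup (Equiv.Perm (Fin d))) : Prop :=
  ∀ i j : Fin d, ∃ σ ∈ F, σ i = j

/-- `F` acts 2-transitively on `{1, …, d}`. -/
def PermTwoTransitive {d : ℕ} (F : Subgroup (Equiv.Perm (Fin d))) : Prop :=
  ∀ a b c e : Fin d, a ≠ b → c ≠ e → ∃ σ ∈ F, σ a = c ∧ σ b = e

/-- `F` acts primitively on `{1, …, d}`: it is transitive and every block of the action
is trivial (a subsingleton or the whole set). -/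
def PermPrimitive {d : ℕ} (F : Subgroup (Equiv.Perm (Fin d))) : Prop :=
  PermTransitive F ∧
    ∀ B : Set (Fin d),
      (∀ σ ∈ F, (σ : Equiv.Perm (Fin d)) '' B = B ∨
        Disjoint ((σ : Equiv.Perm (Fin d)) '' B) B) →
      B.Subsingleton ∨ B = Set.univ

/-- `F` is a cyclic group of prime order. -/
def CyclicOfPrimeOrder {d : ℕ} (F : Subgroup (Equiv.Perm (Fin d))) : Prop :=
  IsCyclic F ∧ (Nat.card F).Prime

/-- `F` is generated by its point stabilizers `F_i = {σ ∈ F : σ i = i}`. -/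
def GenByPointStabilizers {d : ℕ} (F : Subgroup (Equiv.Perm (Fin d))) : Prop :=
  F = Subgroup.closure {σ : Equiv.Perm (Fin d) | σ ∈ F ∧ ∃ i : Fin d, σ i = i}


/-! ### Proof -/

theorem parent_unique (T : SimpleGraph V) (hT : T.IsTree) (r y y' z : V)
    (hy : T.Adj y z) (hy' : T.Adj y' z) (h : T.dist r z = T.dist r y + 1)
    (h' : T.dist r z = T.dist r y' + 1) : y = y' := by
  obtain ⟨p, hp⟩ := hT.connected.exists_walk_length_eq_dist r y
  obtain ⟨q, hq⟩ := hT.connected.exists_walk_length_eq_dist r y'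
  have hp1 : (p.concat hy).IsPath :=
    SimpleGraph.Walk.isPath_of_length_eq_dist _ (by simp [hp, h])
  have hq1 : (q.concat hy').IsPath :=
    SimpleGraph.Walk.isPath_of_length_eq_dist _ (by simp [hq, h'])
  have := (hT.existsUnique_path r z).unique hp1 hq1
  have h2 := congrArg SimpleGraph.Walk.penultimate this
  simpa using h2

theorem exists_parent (T : SimpleGraph V) (hT : T.IsTree) (r z : V) (hz : z ≠ r) :
    ∃ y, T.Adj y z ∧ T.dist r z = T.dist r y + 1 := by
  obtain ⟨p, hp⟩ := hT.connected.exists_walk_length_eq_dist r z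
  have hn : ¬ p.Nil := fun h => hz h.eq.symm
  refine ⟨p.penultimate, p.adj_penultimate hn, ?_⟩
  have h1 := SimpleGraph.dist_le p.dropLast
  have h3 : 0 < p.length := by
    rcases Nat.eq_zero_or_pos p.length with h | h
    · exact absurd (SimpleGraph.Walk.nil_iff_length_eq.mpr h) hn
    · exact h
  have h4 : p.dropLast.length + 1 = p.length := by
    simp [SimpleGraph.Walk.dropLast, SimpleGraph.Walk.take_length]
    omega
  have := hT.dist_eq_dist_add_one_of_adj r (p.adj_penultimate hn)
  omega

theorem side_cross (T : SimpleGraph V) (hT : T.IsTree) (a b y z : V) (hab : T.Adj a b)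
    (hyz : T.Adj y z) (hy : y ∈ EdgeSide T a b) (hz : z ∉ EdgeSide T a b) : y = a ∧ z = b := by
  simp only [EdgeSide, Set.mem_setOf_eq] at hy hz
  have e1 := hT.dist_eq_dist_add_one_of_adj z hab
  have e2 := hT.dist_eq_dist_add_one_of_adj a hyz
  have e3 := hT.dist_eq_dist_add_one_of_adj b hyz
  rw [T.dist_comm (u := z), T.dist_comm (u := z)] at e1
  have hzz : z = b := by
    by_contra hzb
    obtain ⟨w, hw, hwd⟩ := exists_parent T hT b z hzb
    have e4 := hT.dist_eq_dist_add_one_of_adj w hab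
    rw [T.dist_comm (u := w), T.dist_comm (u := w)] at e4
    have e5 := hT.dist_eq_dist_add_one_of_adj a hw
    have := parent_unique T hT a y w z hyz hw (by omega) (by omega)
    subst this
    omega
  subst hzz
  have h0 : T.dist z z = 0 := T.dist_self
  have : T.dist a y = 0 := by omega
  exact ⟨((hT.connected.dist_eq_zero_iff).mp this).symm, rfl⟩

/-- `h` acts everywhere on colors by `σ`. -/
def Twist {d : ℕ} (T : SimpleGraph V) (ι : LegalColoring T d) (σ : Equiv.Perm (Fin d))
    (h : V → V) : Prop :=
  ∀ y z, T.Adj y z → T.Adj (h y) (h z) ∧ ι.color (h y) (h z) = σ (ι.color y z)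

theorem twist_unique {d : ℕ} (T : SimpleGraph V) (hT : T.IsTree) (ι : LegalColoring T d)
    (σ : Equiv.Perm (Fin d)) (f g : V → V) (hf : Twist T ι σ f) (hg : Twist T ι σ g)
    (x : V) (hx : f x = g x) : f = g := by
  have key : ∀ (u v : V) (p : T.Walk u v), f u = g u → f v = g v := by
    intro u v p
    induction p with
    | nil => exact id
    | cons hadj p ih =>
      intro hu
      apply ih
      have h1 := hf _ _ hadj
      have h2 := hg _ _ hadj
      rw [hu] at h1
      exact ι.injOn _ h1.1 h2.1 (h1.2.trans h2.2.symm)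
  funext y
  exact key x y (hT.connected x y).some hx

noncomputable def twistAux (x : V) (par : V → V) (s : V → V → V) : ℕ → V → V
  | 0, _ => x
  | n + 1, y => s (twistAux x par s n (par y)) y

theorem exists_twist {d : ℕ} (T : SimpleGraph V) (hT : T.IsTree) (ι : LegalColoring T d)
    (σ : Equiv.Perm (Fin d)) (x : V) : ∃ h : V → V, Twist T ι σ h ∧ h x = x := by
  classical
  have hs : ∀ (v : V) (i : Fin d), ∃ w, T.Adj v w ∧ ι.color v w = i := by
    intro v i
    obtain ⟨w, hw, hw'⟩ := ι.surjOn v (Set.mem_univ i)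
    exact ⟨w, hw, hw'⟩
  choose s hs1 hs2 using hs
  have hp : ∀ z, ∃ y, z ≠ x → T.Adj y z ∧ T.dist x z = T.dist x y + 1 := by
    intro z
    by_cases hz : z = x
    · exact ⟨x, fun h => absurd hz h⟩
    · obtain ⟨y, hy⟩ := exists_parent T hT x z hz
      exact ⟨y, fun _ => hy⟩
  choose par hpar using hp
  let h : V → V := fun y =>
    twistAux x par (fun v y => s v (σ (ι.color (par y) y))) (T.dist x y) y
  have hstep : ∀ y z, T.Adj y z → T.dist x z = T.dist x y + 1 →
      h z = s (h y) (σ (ι.color y z)) := by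
    intro y z hyz hd
    have hzx : z ≠ x := by
      rintro rfl
      simp at hd
    have hpz : par z = y := parent_unique T hT x _ _ z (hpar z hzx).1 hyz (hpar z hzx).2 hd
    simp only [h]
    rw [hd, twistAux, hpz]
  refine ⟨h, ?_, ?_⟩
  · intro y z hyz
    rcases hT.dist_eq_dist_add_one_of_adj x hyz with hd | hd
    · rw [hstep z y hyz.symm hd, ι.symm y z hyz]
      refine ⟨(hs1 _ _).symm, ?_⟩
      rw [← ι.symm _ _ (hs1 _ _), hs2]
    · rw [hstep y z hyz hd]
      exact ⟨hs1 _ _, hs2 _ _⟩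
  · simp [h, twistAux]

theorem exists_twist_iso {d : ℕ} (T : SimpleGraph V) (hT : T.IsTree) (ι : LegalColoring T d)
    (σ : Equiv.Perm (Fin d)) (x : V) : ∃ h : T ≃g T, Twist T ι σ h ∧ h x = x := by
  obtain ⟨h, hh, hx⟩ := exists_twist T hT ι σ x
  obtain ⟨k, hk, kx⟩ := exists_twist T hT ι σ⁻¹ x
  have hid : Twist T ι 1 id := fun y z hyz => ⟨hyz, rfl⟩
  have h1 : k ∘ h = id := by
    refine twist_unique T hT ι 1 _ _ ?_ hid x (by simp [hx, kx])
    intro y z hyz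
    have a := hh y z hyz
    have b := hk _ _ a.1
    exact ⟨b.1, by simp [b.2, a.2]⟩
  have h2 : h ∘ k = id := by
    refine twist_unique T hT ι 1 _ _ ?_ hid x (by simp [hx, kx])
    intro y z hyz
    have a := hk y z hyz
    have b := hh _ _ a.1
    exact ⟨b.1, by simp [b.2, a.2]⟩
  refine ⟨⟨⟨h, k, congrFun h1, congrFun h2⟩, ?_⟩, hh, hx⟩
  intro a b
  constructor
  · intro hab
    have := (hk _ _ hab).1
    have e1 := congrFun h1 a
    have e2 := congrFun h1 b
    simp only [Function.comp, id] at e1 e2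
    simpa [e1, e2] using this
  · intro hab
    exact (hh _ _ hab).1

theorem exists_half_twist {d : ℕ} (T : SimpleGraph V) (hT : T.IsTree) (ι : LegalColoring T d)
    (F : Subgroup (Equiv.Perm (Fin d))) (σ : Equiv.Perm (Fin d)) (hσ : σ ∈ F) (a b : V)
    (hab : T.Adj a b) (hc : σ (ι.color b a) = ι.color b a) :
    ∃ g : T ≃g T, InUF T F ι g ∧ (∀ y ∈ EdgeSide T a b, g y = y) ∧ g b = b ∧
      (∀ y, T.Adj b y → ι.color b (g y) = σ (ι.color b y)) := by
  classical
  obtain ⟨h, hh, hb⟩ := exists_twist_iso T hT ι σ b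
  have ha : h a = a := by
    have := hh b a hab.symm
    rw [hb, hc] at this
    exact ι.injOn b this.1 hab.symm this.2
  have hside : ∀ y, h y ∈ EdgeSide T a b ↔ y ∈ EdgeSide T a b := by
    intro y
    have e1 := iso_dist_eq T h a y
    have e2 := iso_dist_eq T h b y
    rw [ha] at e1
    rw [hb] at e2
    simp only [EdgeSide, Set.mem_setOf_eq, e1, e2]
  have hside' : ∀ y, h.symm y ∈ EdgeSide T a b ↔ y ∈ EdgeSide T a b := by
    intro y
    rw [← hside, h.apply_symm_apply]
  let f : V → V := fun y => if y ∈ EdgeSide T a b then y else h y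
  let f' : V → V := fun y => if y ∈ EdgeSide T a b then y else h.symm y
  have fin : ∀ y ∈ EdgeSide T a b, f y = y := fun y hy => if_pos hy
  have fout : ∀ y, y ∉ EdgeSide T a b → f y = h y := fun y hy => if_neg hy
  have hff' : ∀ y, f' (f y) = y := by
    intro y
    by_cases hy : y ∈ EdgeSide T a b
    · simp [f, f', hy]
    · simp [f, f', hy, hside]
  have hf'f : ∀ y, f (f' y) = y := by
    intro y
    by_cases hy : y ∈ EdgeSide T a b
    · simp [f, f', hy]
    · simp [f, f', hy, hside']
  -- near an inside vertex, `f` is the identity; near an outside vertex it is `h`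
  have nin : ∀ y ∈ EdgeSide T a b, ∀ z, T.Adj y z → f z = z := by
    intro y hy z hyz
    by_cases hz : z ∈ EdgeSide T a b
    · exact fin z hz
    · obtain ⟨-, rfl⟩ := side_cross T hT a b y z hab hyz hy hz
      rw [fout _ hz, hb]
  have nout : ∀ y, y ∉ EdgeSide T a b → ∀ z, T.Adj y z → f z = h z := by
    intro y hy z hyz
    by_cases hz : z ∈ EdgeSide T a b
    · obtain ⟨rfl, -⟩ := side_cross T hT a b z y hab hyz.symm hz hy
      rw [fin _ hz, ha]
    · exact fout z hz
  have hbn : b ∉ EdgeSide T a b := by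
    simp [EdgeSide]
  have hf'b : ∀ y z, T.Adj y z → T.Adj (f y) (f z) := by
    intro y z hyz
    by_cases hy : y ∈ EdgeSide T a b
    · rw [nin y hy z hyz, fin y hy]; exact hyz
    · rw [nout y hy z hyz, fout y hy]; exact (hh y z hyz).1
  have hfinv : ∀ y z, T.Adj (f y) (f z) → T.Adj y z := by
    intro y z hyz
    by_cases hy : y ∈ EdgeSide T a b <;> by_cases hz : z ∈ EdgeSide T a b
    · rwa [fin y hy, fin z hz] at hyz
    · rw [fin y hy, fout z hz] at hyz
      obtain ⟨rfl, h2⟩ := side_cross T hT a b _ _ hab hyz hy (by rwa [hside])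
      have : z = b := h.injective (h2.trans hb.symm)
      rw [this]; exact hab
    · rw [fin z hz, fout y hy] at hyz
      obtain ⟨rfl, h2⟩ := side_cross T hT a b _ _ hab hyz.symm hz (by rwa [hside])
      have : y = b := h.injective (h2.trans hb.symm)
      rw [this]; exact hab.symm
    · rw [fout y hy, fout z hz] at hyz
      exact h.map_adj_iff.mp hyz
  refine ⟨⟨⟨f, f', hff', hf'f⟩, fun {y z} => ⟨hfinv y z, hf'b y z⟩⟩, ?_, fin,
    (fout b hbn).trans hb, ?_⟩
  · intro y
    by_cases hy : y ∈ EdgeSide T a b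
    · refine ⟨1, F.one_mem, fun z hyz => ?_⟩
      change _ = ι.color (f y) (f z)
      rw [nin y hy z hyz, fin y hy]; rfl
    · refine ⟨σ, hσ, fun z hyz => ?_⟩
      change _ = ι.color (f y) (f z)
      rw [nout y hy z hyz, fout y hy]; exact (hh y z hyz).2.symm
  · intro y hy
    change ι.color b (f y) = _
    rw [nout b hbn y hy]
    have := (hh b y hy).2
    rwa [hb] at this

theorem exists_perm {d : ℕ} (F : Subgroup (Equiv.Perm (Fin d)))
    (hprim : PermPrimitive F) (hncyc : ¬ CyclicOfPrimeOrder F) (c c' : Fin d) (hcc : c ≠ c') :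
    ∃ σ ∈ F, σ c = c ∧ σ c' ≠ c' := by
  classical
  by_contra hcon
  push Not at hcon
  obtain ⟨htr, hbl⟩ := hprim
  let S : Fin d → Set (Equiv.Perm (Fin d)) := fun i => {σ | σ ∈ F ∧ σ i = i}
  have conj : ∀ τ ∈ F, ∀ i σ, σ ∈ S i ↔ τ * σ * τ⁻¹ ∈ S (τ i) := by
    intro τ hτ i σ
    simp only [S, Set.mem_setOf_eq, Equiv.Perm.mul_apply]
    refine and_congr ⟨fun h => F.mul_mem (F.mul_mem hτ h) (F.inv_mem hτ), fun h => ?_⟩ (by simp)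
    have := F.mul_mem (F.mul_mem (F.inv_mem hτ) h) hτ
    simpa [mul_assoc] using this
  have hinj : ∀ τ : Equiv.Perm (Fin d),
      Function.Injective (fun σ : Equiv.Perm (Fin d) => τ * σ * τ⁻¹) := by
    intro τ x y hxy
    simpa using hxy
  have himg : ∀ τ ∈ F, ∀ i, (fun σ : Equiv.Perm (Fin d) => τ * σ * τ⁻¹) '' S i = S (τ i) := by
    intro τ hτ i
    ext ρ
    constructor
    · rintro ⟨σ, hσ, rfl⟩
      exact (conj τ hτ i σ).mp hσ
    · intro hρ
      refine ⟨τ⁻¹ * ρ * τ, ?_, by simp [mul_assoc]⟩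
      rw [conj τ hτ]
      simpa [mul_assoc] using hρ
  have heq : S c' = S c := by
    obtain ⟨τ, hτ, rfl⟩ := htr c c'
    have hsub : S c ⊆ S (τ c) := fun σ hσ => ⟨hσ.1, hcon σ hσ.1 hσ.2⟩
    refine (Set.eq_of_subset_of_ncard_le hsub ?_ (Set.toFinite _)).symm
    rw [← himg τ hτ c, Set.ncard_image_of_injective _ (hinj τ)]
  have hB : ∀ j, S j = S c := by
    have := hbl {j | S j = S c} ?_
    · rcases this with h | h
      · exact absurd (h (show c ∈ {j | S j = S c} from rfl) heq) hcc
      · intro j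
        have : j ∈ {j | S j = S c} := h ▸ Set.mem_univ j
        exact this
    · intro τ hτ
      by_cases hd : Disjoint ((τ : Equiv.Perm (Fin d)) '' {j | S j = S c}) {j | S j = S c}
      · exact Or.inr hd
      · left
        rw [Set.not_disjoint_iff] at hd
        obtain ⟨_, ⟨j, hj, rfl⟩, hk⟩ := hd
        simp only [Set.mem_setOf_eq] at hj hk
        have hk2 : ∀ i, S (τ i) = S c ↔ S i = S c := by
          intro i
          have h3 : S (τ i) = S (τ j) ↔ S i = S j := by
            rw [← himg τ hτ, ← himg τ hτ, (hinj τ).image_injective.eq_iff]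
          rwa [hk, hj] at h3
        ext k
        constructor
        · rintro ⟨i, hi, rfl⟩
          exact (hk2 i).mpr hi
        · intro hk'
          refine ⟨τ⁻¹ k, ?_, by simp⟩
          rw [Set.mem_setOf_eq, ← hk2]
          simpa using hk'
  have hfree : ∀ σ ∈ F, ∀ j, σ j = j → σ = 1 := by
    intro σ hσ j hj
    ext k
    have : σ ∈ S k := by
      rw [hB k, ← hB j]
      exact ⟨hσ, hj⟩
    simp [this.2]
  have hgen : ∀ σ ∈ F, σ ≠ 1 → ∀ τ ∈ F, τ ∈ Subgroup.zpowers σ := by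
    intro σ hσ hne
    have hz : ∀ ρ ∈ Subgroup.zpowers σ, ρ ∈ F := by
      intro ρ hρ
      exact (Subgroup.zpowers_le.mpr hσ) hρ
    have hcancel : ∀ α ∈ F, ∀ β ∈ F, ∀ j, α j = β j → α = β := by
      intro α hα β hβ j hj
      have := hfree (β⁻¹ * α) (F.mul_mem (F.inv_mem hβ) hα) j (by simp [hj])
      exact (inv_mul_eq_one.mp this).symm
    have := hbl {j | ∃ ρ ∈ Subgroup.zpowers σ, ρ c = j} ?_
    · rcases this with h | h
      · exfalso
        have h1 : σ c = c := h ⟨σ, Subgroup.mem_zpowers σ, rfl⟩ ⟨1, Subgroup.one_mem _, rfl⟩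
        exact hne (hfree σ hσ c h1)
      · intro τ hτ
        have : τ c ∈ {j | ∃ ρ ∈ Subgroup.zpowers σ, ρ c = j} := h ▸ Set.mem_univ _
        obtain ⟨ρ, hρ, he⟩ := this
        rw [← hcancel ρ (hz ρ hρ) τ hτ c he]
        exact hρ
    · intro τ hτ
      by_cases hd : Disjoint ((τ : Equiv.Perm (Fin d)) '' {j | ∃ ρ ∈ Subgroup.zpowers σ, ρ c = j})
          {j | ∃ ρ ∈ Subgroup.zpowers σ, ρ c = j}
      · exact Or.inr hd
      · left
        rw [Set.not_disjoint_iff] at hd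
        obtain ⟨_, ⟨_, ⟨ρ, hρ, rfl⟩, rfl⟩, ⟨ρ', hρ', he⟩⟩ := hd
        have h1 : ρ' = τ * ρ := hcancel ρ' (hz _ hρ') (τ * ρ) (F.mul_mem hτ (hz _ hρ)) c he
        have hτz : τ ∈ Subgroup.zpowers σ := by
          have : τ = ρ' * ρ⁻¹ := by rw [h1]; simp
          rw [this]
          exact Subgroup.mul_mem _ hρ' (Subgroup.inv_mem _ hρ)
        ext k
        constructor
        · rintro ⟨_, ⟨ρ, hρ, rfl⟩, rfl⟩
          exact ⟨τ * ρ, Subgroup.mul_mem _ hτz hρ, rfl⟩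
        · rintro ⟨ρ, hρ, rfl⟩
          exact ⟨_, ⟨τ⁻¹ * ρ, Subgroup.mul_mem _ (Subgroup.inv_mem _ hτz) hρ, rfl⟩, by simp⟩
  apply hncyc
  have hgen' : ∀ σ : F, σ ≠ 1 → ∀ τ : F, τ ∈ Subgroup.zpowers σ := by
    intro σ hσ τ
    obtain ⟨k, hk⟩ := hgen σ σ.2 (fun h => hσ (Subtype.ext h)) τ τ.2
    exact ⟨k, Subtype.ext (by simpa using hk)⟩
  obtain ⟨τ, hτ, hτc⟩ := htr c c'
  have hτ1 : (⟨τ, hτ⟩ : F) ≠ 1 := by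
    intro h
    have : τ = 1 := congrArg Subtype.val h
    rw [this] at hτc
    exact hcc hτc
  refine ⟨⟨⟨_, hgen' _ hτ1⟩⟩, ?_⟩
  haveI : Nontrivial F := ⟨⟨_, _, hτ1⟩⟩
  obtain ⟨p, hp, hpd⟩ := Nat.exists_prime_and_dvd (n := Nat.card F)
    (Finite.one_lt_card (α := F)).ne'
  haveI := Fact.mk hp
  obtain ⟨x, hx⟩ := exists_prime_orderOf_dvd_card' p hpd
  have hx1 : x ≠ 1 := by
    rintro rfl
    rw [orderOf_one] at hx
    exact hp.one_lt.ne hx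
  have := orderOf_eq_card_of_forall_mem_zpowers (hgen' x hx1)
  rw [← this, hx]
  exact hp

/-- Let `F` be primitive but not cyclic of prime order and
`𝔾 = U(F)⁺`.  Then for every end `ξ ∈ ∂𝒯` the subgroup `𝔾_ξ⁰` is not compact. -/
theorem end_stabilizer_not_compact
    {V : Type} (T : SimpleGraph V) (d : ℕ) (hd : 3 ≤ d)
    (hT : T.IsTree) (hreg : Regular T d) (ι : LegalColoring T d)
    (F : Subgroup (Equiv.Perm (Fin d)))
    (hprim : PermPrimitive F) (hncyc : ¬ CyclicOfPrimeOrder F) :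
    ∀ ξ : GeodRay T, ¬ IsCompact (EndStab0 T (UFplus T F ι) ξ) := by
  intro ξ hcomp
  have hg : ∀ n : ℕ, ∃ g : T ≃g T, g ∈ UFplus T F ι ∧ (∀ k, n + 1 ≤ k → g (ξ.seq k) = ξ.seq k) ∧
      g (ξ.seq n) ≠ ξ.seq n := by
    intro n
    have a1 := ξ.adj n
    have a2 := ξ.adj (n + 1)
    have hne : ξ.seq (n + 2) ≠ ξ.seq n := by
      intro h
      have := ξ.geodesic (n + 2) n
      rw [h, T.dist_self] at this
      simp [Nat.dist] at this
    have hcne : ι.color (ξ.seq (n + 1)) (ξ.seq (n + 2)) ≠ ι.color (ξ.seq (n + 1)) (ξ.seq n) :=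
      fun h => hne (ι.injOn _ a2 a1.symm h)
    obtain ⟨σ, hσ, h1, h2⟩ := exists_perm F hprim hncyc _ _ hcne
    obtain ⟨g, hgU, hgs, hgb, hgc⟩ :=
      exists_half_twist T hT ι F σ hσ (ξ.seq (n + 2)) (ξ.seq (n + 1)) a2.symm h1
    have hfix : ∀ k, n + 1 ≤ k → g (ξ.seq k) = ξ.seq k := by
      intro k hk
      rcases hk.eq_or_lt with rfl | hk
      · exact hgb
      · apply hgs
        simp only [EdgeSide, Set.mem_setOf_eq, ξ.geodesic, Nat.dist]
        omega
    refine ⟨g, ?_, hfix, ?_⟩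
    · exact Subgroup.subset_closure ⟨hgU, _, _, a2, hfix _ le_rfl, hfix _ (by omega)⟩
    · intro h
      have := hgc _ a1.symm
      rw [h] at this
      exact h2 this.symm
  choose g hgG hgfix hgmove using hg
  letI : TopologicalSpace V := ⊥
  haveI : DiscreteTopology V := ⟨rfl⟩
  have hcont : Continuous (fun g : UFplus T F ι => (g : T ≃g T) (ξ.seq 0)) := by
    have h1 : Continuous (fun (g : T ≃g T) (x : V) => g x) := continuous_induced_dom
    exact ((continuous_apply (ξ.seq 0)).comp h1).comp continuous_subtype_val
  have hfin := (hcomp.image hcont).finite_of_discrete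
  have hinj : Function.Injective (fun n => g n (ξ.seq 0)) := by
    have key : ∀ n m, n < m → g n (ξ.seq 0) ≠ g m (ξ.seq 0) := by
      intro n m hnm h
      apply hgmove m
      have e : g n (ξ.seq m) = ξ.seq m := hgfix n m hnm
      refine parent_unique T hT (g m (ξ.seq 0)) _ _ (ξ.seq (m + 1)) ?_ (ξ.adj m) ?_ ?_
      · have := (g m).map_adj_iff.mpr (ξ.adj m)
        rwa [hgfix m (m + 1) le_rfl] at this
      · conv_lhs => rw [← hgfix m (m + 1) le_rfl]
        rw [iso_dist_eq, iso_dist_eq, ξ.geodesic, ξ.geodesic]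
        simp [Nat.dist]
      · rw [← h]
        conv_lhs => rw [← hgfix n (m + 1) (by omega)]
        conv_rhs => rw [← e]
        rw [iso_dist_eq, iso_dist_eq, ξ.geodesic, ξ.geodesic]
        simp [Nat.dist]
    intro n m h
    rcases lt_trichotomy n m with h1 | h1 | h1
    · exact absurd h (key n m h1)
    · exact h1
    · exact absurd h.symm (key m n h1)
  refine Set.infinite_range_of_injective hinj (hfin.subset ?_)
  rintro _ ⟨n, rfl⟩
  refine ⟨⟨g n, hgG n⟩, ⟨⟨n + 1, n + 1, fun k => ?_⟩, ξ.seq (n + 1), hgfix n _ le_rfl⟩, rfl⟩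
  exact hgfix n _ (by omega)

end TreeHM
end

section
/- Let d ≥ 3 and let F ≤ Sym({1,…,d}) be primitive but not cyclic of prime order. Then: (a) every hyperbolic element of U(F)⁺ has even translation length; and (b) for every pair of unoriented edges e, e' of 𝒯 at odd distance from each other (where the distance between two edges is the minimal graph distance between an endpoint of e and an endpoint of e'), there exists a hyperbolic element g ∈ U(F)⁺ with g(e) = e'. -/
open Filter Topology
open scoped InnerProductSpace

namespace TreeHM

variable {V : Type}

section Helpers

open SimpleGraph

theorem dist_parity_adj (T : SimpleGraph V) (hT : T.IsTree) (x y z : V) (h : T.Adj y z) :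
    T.dist x z = T.dist x y + 1 ∨ T.dist x y = T.dist x z + 1 := by
  have h1 := hT.dist_ne_of_adj x h
  have h2 := h.diff_dist_adj (u := x)
  omega

theorem walk_parity (T : SimpleGraph V) (hT : T.IsTree) (x : V) {y z : V} (p : T.Walk y z) :
    (p.length + T.dist x y + T.dist x z) % 2 = 0 := by
  induction p with
  | nil => simp; omega
  | cons h p ih =>
    have := dist_parity_adj T hT x _ _ h
    simp only [Walk.length_cons]
    omega

theorem dist_parity (T : SimpleGraph V) (hT : T.IsTree) (x y z : V) :
    (T.dist y z + T.dist x y + T.dist x z) % 2 = 0 := by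
  obtain ⟨p, hp⟩ := hT.connected.exists_walk_length_eq_dist y z
  rw [← hp]
  exact walk_parity T hT x p

theorem UFplus_even {d : ℕ} (T : SimpleGraph V) (hT : T.IsTree)
    (F : Subgroup (Equiv.Perm (Fin d))) (ι : LegalColoring T d) (g : T ≃g T)
    (hg : g ∈ UFplus T F ι) : ∀ y, T.dist y (g y) % 2 = 0 := by
  induction hg using Subgroup.closure_induction with
  | mem g hg =>
    obtain ⟨-, x, -, -, hx, -⟩ := hg
    intro y
    have h1 := iso_dist_eq T g x y
    rw [hx] at h1
    have := dist_parity T hT x y (g y)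
    omega
  | one => intro y; simp
  | mul g h _ _ ihg ihh =>
    intro y
    have h1 := ihh y
    have h2 := ihg (h y)
    have h3 := dist_parity T hT (h y) y (g (h y))
    rw [T.dist_comm (u := h y) (v := y)] at h3
    change T.dist y (g (h y)) % 2 = 0
    omega
  | inv g _ ih =>
    intro y
    have h1 := ih (g⁻¹ y)
    have h2 : g (g⁻¹ y) = y := by
      change (g * g⁻¹) y = y
      simp
    rw [h2, T.dist_comm] at h1
    exact h1

theorem dist_cross (T : SimpleGraph V) (hT : T.IsTree) (a b x c : V) (hab : T.Adj a b)
    (h1 : T.dist x b = T.dist x a + 1) (h2 : T.dist a c = T.dist b c + 1) :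
    T.dist x c = T.dist x a + T.dist a c := by
  classical
  obtain ⟨p, hp, hpl⟩ := hT.connected.exists_path_of_dist x a
  obtain ⟨q, hq, hql⟩ := hT.connected.exists_path_of_dist b c
  obtain ⟨r, hr, hrl⟩ := hT.connected.exists_path_of_dist x c
  have key : (p.append (Walk.cons hab q)).IsPath := by
    rw [Walk.isPath_def, Walk.support_append]
    simp only [Walk.support_cons, List.tail_cons]
    rw [List.nodup_append]
    refine ⟨hp.support_nodup, hq.support_nodup, ?_⟩
    rintro y hy z hz rfl
    have e1 := congrArg Walk.length (p.take_spec hy)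
    have e2 := congrArg Walk.length (q.take_spec hz)
    rw [Walk.length_append] at e1 e2
    have f1 := T.dist_le (p.takeUntil y hy)
    have f2 := T.dist_le (p.dropUntil y hy)
    have f3 := T.dist_le (q.takeUntil y hz)
    have f4 := T.dist_le (q.dropUntil y hz)
    have t1 := hT.connected.dist_triangle (u := x) (v := y) (w := b)
    have t2 := hT.connected.dist_triangle (u := a) (v := y) (w := c)
    rw [T.dist_comm (u := y) (v := b)] at t1
    rw [T.dist_comm (u := a) (v := y)] at t2
    omega
  have := (hT.existsUnique_path x c).unique hr key
  rw [← hrl, this, Walk.length_append, Walk.length_cons]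
  omega

theorem no_fix (T : SimpleGraph V) (hT : T.IsTree) (a b c e : V) (hab : T.Adj a b)
    (hce : T.Adj c e) (h1 : T.dist a c = T.dist b c + 1) (h2 : T.dist b e = T.dist b c + 1)
    (g : T ≃g T) (ga : g a = c) (gb : g b = e) (x : V) : g x ≠ x := by
  intro hx
  have d1 := iso_dist_eq T g x a
  have d2 := iso_dist_eq T g x b
  rw [hx, ga] at d1
  rw [hx, gb] at d2
  rcases dist_parity_adj T hT x a b hab with h | h
  · have := dist_cross T hT a b x c hab h h1
    omega
  · have := dist_cross T hT e c x b hce.symm (by omega)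
      (by rw [T.dist_comm (u := e), T.dist_comm (u := c)]; exact h2)
    rw [T.dist_comm (u := e)] at this
    omega

/-! Steps along colors -/

theorem exists_step {d : ℕ} (T : SimpleGraph V) (ι : LegalColoring T d) (x : V) (i : Fin d) :
    ∃ y, T.Adj x y ∧ ι.color x y = i := by
  obtain ⟨y, hy, h⟩ := ι.surjOn x (Set.mem_univ i)
  exact ⟨y, hy, h⟩

noncomputable def step {d : ℕ} (T : SimpleGraph V) (ι : LegalColoring T d) (x : V) (i : Fin d) :
    V := (exists_step T ι x i).choose

theorem step_adj {d : ℕ} (T : SimpleGraph V) (ι : LegalColoring T d) (x : V) (i : Fin d) :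
    T.Adj x (step T ι x i) := (exists_step T ι x i).choose_spec.1

theorem step_color {d : ℕ} (T : SimpleGraph V) (ι : LegalColoring T d) (x : V) (i : Fin d) :
    ι.color x (step T ι x i) = i := (exists_step T ι x i).choose_spec.2

theorem step_of_adj {d : ℕ} (T : SimpleGraph V) (ι : LegalColoring T d) (x y : V)
    (h : T.Adj x y) : step T ι x (ι.color x y) = y :=
  ι.injOn x (step_adj T ι x _) h (step_color T ι x _)

theorem step_step {d : ℕ} (T : SimpleGraph V) (ι : LegalColoring T d) (x : V) (i : Fin d) :
    step T ι (step T ι x i) i = x := by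
  have h := step_of_adj T ι (step T ι x i) x (step_adj T ι x i).symm
  rwa [ι.symm _ _ (step_adj T ι x i).symm, step_color] at h

noncomputable def foll {d : ℕ} (T : SimpleGraph V) (ι : LegalColoring T d)
    (σ : Equiv.Perm (Fin d)) : {x y : V} → T.Walk x y → V → V
  | _, _, Walk.nil, z => z
  | u, _, Walk.cons (v := v) _ p, z => foll T ι σ p (step T ι z (σ (ι.color u v)))

theorem foll_concat {d : ℕ} (T : SimpleGraph V) (ι : LegalColoring T d)
    (σ : Equiv.Perm (Fin d)) {x y w : V} (p : T.Walk x y) (h : T.Adj y w) (z : V) :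
    foll T ι σ (p.concat h) z = step T ι (foll T ι σ p z) (σ (ι.color y w)) := by
  induction p generalizing z with
  | nil => simp [Walk.concat, foll]
  | cons h' p ih => simp only [Walk.concat_cons, foll]; exact ih h _

theorem exists_equivariant {d : ℕ} (T : SimpleGraph V) (hT : T.IsTree) (ι : LegalColoring T d)
    (σ : Equiv.Perm (Fin d)) (x : V) :
    ∃ f : V → V, f x = x ∧ ∀ y i, f (step T ι y i) = step T ι (f y) (σ i) := by
  choose P hP using fun y => (hT.existsUnique_path x y).exists
  have main : ∀ y z, T.Adj y z → y ∈ (P z).support →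
      foll T ι σ (P z) x = step T ι (foll T ι σ (P y) x) (σ (ι.color y z)) := by
    intro y z h hy
    rw [hT.isAcyclic.path_concat (hP y) (hP z) h hy, foll_concat]
  refine ⟨fun y => foll T ι σ (P y) x, ?_, ?_⟩
  · have : P x = Walk.nil := (hT.existsUnique_path x x).unique (hP x) Walk.IsPath.nil
    simp [this, foll]
  · intro y i
    have h := step_adj T ι y i
    have hc := step_color T ι y i
    by_cases hy : y ∈ (P (step T ι y i)).support
    · have := main y _ h hy
      rwa [hc] at this
    · have := main _ y h.symm
        (hT.isAcyclic.mem_support_of_ne_mem_support_of_adj_of_isPath (hP y) (hP _) h hy)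
      rw [ι.symm _ _ h.symm, hc] at this
      simp only [this, step_step]

theorem equivariant_id {d : ℕ} (T : SimpleGraph V) (hT : T.IsTree) (ι : LegalColoring T d)
    (x : V) (f : V → V) (hx : f x = x) (hf : ∀ y i, f (step T ι y i) = step T ι (f y) i) (y : V) :
    f y = y := by
  obtain ⟨p⟩ := hT.connected x y
  induction p with
  | nil => exact hx
  | @cons u v w h p ih =>
    apply ih
    have := hf u (ι.color u v)
    rwa [hx, step_of_adj T ι u v h] at this

theorem exists_aut {d : ℕ} (T : SimpleGraph V) (hT : T.IsTree) (ι : LegalColoring T d)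
    (σ : Equiv.Perm (Fin d)) (x : V) :
    ∃ g : T ≃g T, g x = x ∧ ∀ y i, g (step T ι y i) = step T ι (g y) (σ i) := by
  obtain ⟨f, fx, hf⟩ := exists_equivariant T hT ι σ x
  obtain ⟨f', fx', hf'⟩ := exists_equivariant T hT ι σ⁻¹ x
  have adj : ∀ (k : V → V) (τ : Equiv.Perm (Fin d)),
      (∀ y i, k (step T ι y i) = step T ι (k y) (τ i)) → ∀ y z, T.Adj y z → T.Adj (k y) (k z) := by
    intro k τ hk y z h
    rw [← step_of_adj T ι y z h, hk]
    exact step_adj T ι _ _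
  have l1 : ∀ y, f' (f y) = y := equivariant_id T hT ι x (fun y => f' (f y)) (by simp [fx, fx'])
    (by intro y i; simp [hf, hf'])
  have l2 : ∀ y, f (f' y) = y := equivariant_id T hT ι x (fun y => f (f' y)) (by simp [fx, fx'])
    (by intro y i; simp [hf, hf'])
  refine ⟨⟨⟨f, f', l1, l2⟩, ?_⟩, fx, hf⟩
  intro y z
  constructor
  · intro h
    have := adj f' _ hf' _ _ h
    simpa [l1] using this
  · exact adj f _ hf y z

theorem gen_mem {d : ℕ} (T : SimpleGraph V) (hT : T.IsTree) (ι : LegalColoring T d)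
    (F : Subgroup (Equiv.Perm (Fin d))) (x : V) (τ : Equiv.Perm (Fin d))
    (hτ : τ ∈ Subgroup.closure {σ : Equiv.Perm (Fin d) | σ ∈ F ∧ ∃ i : Fin d, σ i = i}) :
    ∃ g ∈ UFplus T F ι, g x = x ∧ ∀ i, g (step T ι x i) = step T ι x (τ i) := by
  induction hτ using Subgroup.closure_induction with
  | mem σ hσ =>
    obtain ⟨hF, k, hk⟩ := hσ
    obtain ⟨g, gx, hg⟩ := exists_aut T hT ι σ x
    refine ⟨g, Subgroup.subset_closure ⟨?_, x, step T ι x k, step_adj T ι x k, gx, ?_⟩, gx, ?_⟩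
    · intro y
      refine ⟨σ, hF, fun z hz => ?_⟩
      have := hg y (ι.color y z)
      rw [step_of_adj T ι y z hz] at this
      rw [this, step_color]
    · rw [hg, gx, hk]
    · intro i; rw [hg, gx]
  | one => exact ⟨1, Subgroup.one_mem _, rfl, fun i => rfl⟩
  | mul σ τ _ _ ih1 ih2 =>
    obtain ⟨g, hg, gx, hg'⟩ := ih1
    obtain ⟨h, hh, hx, hh'⟩ := ih2
    refine ⟨g * h, Subgroup.mul_mem _ hg hh, ?_, fun i => ?_⟩
    · change g (h x) = x
      rw [hx, gx]
    · change g (h _) = _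
      rw [hh', hg']; rfl
  | inv σ _ ih =>
    obtain ⟨g, hg, gx, hg'⟩ := ih
    have inv : ∀ y z, g y = z → g⁻¹ z = y := by
      rintro y _ rfl
      change (g⁻¹ * g) y = y
      simp
    refine ⟨g⁻¹, Subgroup.inv_mem _ hg, inv _ _ gx, fun i => inv _ _ ?_⟩
    rw [hg']; simp

/-! Permutation groups -/

theorem closure_trans {d : ℕ} (hd : 3 ≤ d) (F : Subgroup (Equiv.Perm (Fin d)))
    (hprim : PermPrimitive F) (hncyc : ¬ CyclicOfPrimeOrder F) (i j : Fin d) :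
    ∃ τ ∈ Subgroup.closure {σ : Equiv.Perm (Fin d) | σ ∈ F ∧ ∃ i : Fin d, σ i = i}, τ i = j := by
  obtain ⟨htr, hbl⟩ := hprim
  set N := Subgroup.closure {σ : Equiv.Perm (Fin d) | σ ∈ F ∧ ∃ i : Fin d, σ i = i} with hN
  have hconj : ∀ σ ∈ F, ∀ τ ∈ N, σ * τ * σ⁻¹ ∈ N := by
    intro σ hσ τ hτ
    induction hτ using Subgroup.closure_induction with
    | mem τ hτ =>
      obtain ⟨h1, k, hk⟩ := hτ
      refine Subgroup.subset_closure ⟨F.mul_mem (F.mul_mem hσ h1) (F.inv_mem hσ), σ k, ?_⟩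
      simp [hk]
    | one => simp
    | mul a b _ _ iha ihb =>
      have := N.mul_mem iha ihb
      convert this using 1
      group
    | inv a _ ih =>
      have := N.inv_mem ih
      convert this using 1
      group
  -- orbits are blocks
  have horb : ∀ i : Fin d, {j | ∃ τ ∈ N, τ i = j}.Subsingleton ∨
      {j | ∃ τ ∈ N, τ i = j} = Set.univ := by
    intro i
    apply hbl
    intro σ hσ
    by_cases hdis : Disjoint ((σ : Equiv.Perm (Fin d)) '' {j | ∃ τ ∈ N, τ i = j})
      {j | ∃ τ ∈ N, τ i = j}
    · exact Or.inr hdis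
    left
    rw [Set.not_disjoint_iff] at hdis
    obtain ⟨_, ⟨_, ⟨τ, hτ, rfl⟩, rfl⟩, ρ, hρ, h⟩ := hdis
    -- σ (τ i) = ρ i ; so σ i ∈ orbit
    have hm : ∃ κ ∈ N, σ i = κ i := by
      refine ⟨(σ * τ * σ⁻¹)⁻¹ * ρ, N.mul_mem (N.inv_mem (hconj σ hσ τ hτ)) hρ, ?_⟩
      simp [h]
    obtain ⟨κ, hκ, hκi⟩ := hm
    ext y
    constructor
    · rintro ⟨_, ⟨μ, hμ, rfl⟩, rfl⟩
      refine ⟨(σ * μ * σ⁻¹) * κ, N.mul_mem (hconj σ hσ μ hμ) hκ, ?_⟩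
      simp [← hκi]
    · rintro ⟨μ, hμ, rfl⟩
      refine ⟨σ⁻¹ (μ i), ⟨σ⁻¹ * (μ * κ⁻¹) * σ⁻¹⁻¹,
        hconj _ (F.inv_mem hσ) _ (N.mul_mem hμ (N.inv_mem hκ)), ?_⟩, by simp⟩
      simp [hκi]
  by_cases hall : ∀ i : Fin d, {j | ∃ τ ∈ N, τ i = j}.Subsingleton
  swap
  · push Not at hall
    obtain ⟨k, hk⟩ := hall
    have hu := (horb k).resolve_left (by simpa using hk)
    have h1 : ∀ j, ∃ τ ∈ N, τ k = j := fun j => by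
      have : j ∈ {j | ∃ τ ∈ N, τ k = j} := hu ▸ Set.mem_univ j
      exact this
    obtain ⟨τ, hτ, e1⟩ := h1 i
    obtain ⟨ρ, hρ, e2⟩ := h1 j
    refine ⟨ρ * τ⁻¹, N.mul_mem hρ (N.inv_mem hτ), ?_⟩
    simp [← e1, e2]
  exfalso
  apply hncyc
  -- F acts freely
  have hfree : ∀ σ ∈ F, ∀ k, σ k = k → σ = 1 := by
    intro σ hσ k hk
    have hmem : σ ∈ N := Subgroup.subset_closure ⟨hσ, k, hk⟩
    ext1 l
    exact hall l ⟨σ, hmem, rfl⟩ ⟨1, N.one_mem, rfl⟩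
  have hcard : Nat.card F ≠ 1 := by
    intro h1
    rw [Subgroup.card_eq_one] at h1
    obtain ⟨σ, hσ, h⟩ := htr ⟨0, by omega⟩ ⟨1, by omega⟩
    rw [h1, Subgroup.mem_bot] at hσ
    rw [hσ] at h
    simp at h
  obtain ⟨p, hp, hpd⟩ := Nat.exists_prime_and_dvd hcard
  haveI := Fact.mk hp
  obtain ⟨s, hs⟩ := exists_prime_orderOf_dvd_card' (G := F) p hpd
  have htop : Subgroup.zpowers s = ⊤ := by
    let k : Fin d := ⟨0, by omega⟩
    have hB := hbl {j | ∃ τ ∈ Subgroup.zpowers s, (τ : Equiv.Perm (Fin d)) k = j} (by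
      intro σ hσ
      by_cases hdis : Disjoint ((σ : Equiv.Perm (Fin d)) ''
        {j | ∃ τ ∈ Subgroup.zpowers s, (τ : Equiv.Perm (Fin d)) k = j})
        {j | ∃ τ ∈ Subgroup.zpowers s, (τ : Equiv.Perm (Fin d)) k = j}
      · exact Or.inr hdis
      left
      rw [Set.not_disjoint_iff] at hdis
      obtain ⟨_, ⟨_, ⟨τ, hτ, rfl⟩, rfl⟩, ρ, hρ, h⟩ := hdis
      have e : (ρ⁻¹ * ⟨σ, hσ⟩ * τ : F) = 1 := by
        apply Subtype.ext
        apply hfree _ (ρ⁻¹ * ⟨σ, hσ⟩ * τ : F).2 k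
        simp [← h]
      have hσ' : (⟨σ, hσ⟩ : F) ∈ Subgroup.zpowers s := by
        have : (⟨σ, hσ⟩ : F) = ρ * (ρ⁻¹ * ⟨σ, hσ⟩ * τ : F) * τ⁻¹ := by group
        rw [this, e, mul_one]
        exact mul_mem hρ (inv_mem hτ)
      ext y
      constructor
      · rintro ⟨_, ⟨μ, hμ, rfl⟩, rfl⟩
        exact ⟨⟨σ, hσ⟩ * μ, mul_mem hσ' hμ, by simp⟩
      · rintro ⟨μ, hμ, rfl⟩
        exact ⟨_, ⟨(⟨σ, hσ⟩ : F)⁻¹ * μ, mul_mem (inv_mem hσ') hμ, rfl⟩, by simp⟩)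
    rcases hB with hB | hB
    · exfalso
      have := hB ⟨s, Subgroup.mem_zpowers s, rfl⟩ ⟨1, one_mem _, rfl⟩
      have h1 := hfree s s.2 k (by simpa using this)
      have : s = 1 := Subtype.ext h1
      rw [this, orderOf_one] at hs
      exact hp.one_lt.ne hs
    · rw [eq_top_iff]
      intro σ _
      have : (σ : Equiv.Perm (Fin d)) k ∈
        {j | ∃ τ ∈ Subgroup.zpowers s, (τ : Equiv.Perm (Fin d)) k = j} := hB ▸ Set.mem_univ _
      obtain ⟨τ, hτ, h⟩ := this
      have e : (τ⁻¹ * σ : F) = 1 := by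
        apply Subtype.ext
        apply hfree _ (τ⁻¹ * σ : F).2 k
        simp [← h]
      rw [inv_mul_eq_one] at e
      rwa [← e]
  have hc : Nat.card F = p := by
    rw [← hs, ← Nat.card_zpowers, htop, Subgroup.card_top]
  exact ⟨isCyclic_of_prime_card hc, hc ▸ hp⟩

theorem rotate {d : ℕ} (hd : 3 ≤ d) (T : SimpleGraph V) (hT : T.IsTree) (ι : LegalColoring T d)
    (F : Subgroup (Equiv.Perm (Fin d)))
    (hprim : PermPrimitive F) (hncyc : ¬ CyclicOfPrimeOrder F) (x y z : V)
    (hy : T.Adj x y) (hz : T.Adj x z) : ∃ g ∈ UFplus T F ι, g x = x ∧ g y = z := by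
  obtain ⟨τ, hτ, h⟩ := closure_trans hd F hprim hncyc (ι.color x y) (ι.color x z)
  obtain ⟨g, hg, gx, hg'⟩ := gen_mem T hT ι F x τ hτ
  refine ⟨g, hg, gx, ?_⟩
  have := hg' (ι.color x y)
  rwa [h, step_of_adj T ι x y hy, step_of_adj T ι x z hz] at this

theorem edge_trans {d : ℕ} (hd : 3 ≤ d) (T : SimpleGraph V) (hT : T.IsTree)
    (ι : LegalColoring T d) (F : Subgroup (Equiv.Perm (Fin d)))
    (hprim : PermPrimitive F) (hncyc : ¬ CyclicOfPrimeOrder F) {a c : V} (p : T.Walk a c) :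
    ∀ b e : V, T.Adj a b → T.Adj c e →
      (p.length % 2 = 0 → ∃ g ∈ UFplus T F ι, g a = c ∧ g b = e) ∧
      (p.length % 2 = 1 → ∃ g ∈ UFplus T F ι, g a = e ∧ g b = c) := by
  induction p with
  | nil =>
    intro b e hab hce
    refine ⟨fun _ => rotate hd T hT ι F hprim hncyc _ _ _ hab hce, fun h => by simp at h⟩
  | @cons a a' c haa' p ih =>
    intro b e hab hce
    obtain ⟨g, hg, ga, gb⟩ := rotate hd T hT ι F hprim hncyc a b a' hab haa'
    obtain ⟨h0, h1⟩ := ih a e haa'.symm hce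
    constructor
    · intro hl
      obtain ⟨h, hh, e1, e2⟩ := h1 (by simp at hl; omega)
      refine ⟨h * g, mul_mem hh hg, ?_, ?_⟩
      · change h (g a) = c
        rw [ga, e2]
      · change h (g b) = e
        rw [gb, e1]
    · intro hl
      obtain ⟨h, hh, e1, e2⟩ := h0 (by simp at hl; omega)
      refine ⟨h * g, mul_mem hh hg, ?_, ?_⟩
      · change h (g a) = e
        rw [ga, e2]
      · change h (g b) = c
        rw [gb, e1]

theorem exists_hyp {d : ℕ} (hd : 3 ≤ d) (T : SimpleGraph V) (hT : T.IsTree)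
    (ι : LegalColoring T d) (F : Subgroup (Equiv.Perm (Fin d)))
    (hprim : PermPrimitive F) (hncyc : ¬ CyclicOfPrimeOrder F) (a b c e : V)
    (hab : T.Adj a b) (hce : T.Adj c e) (hodd : T.dist b c % 2 = 1)
    (h1 : T.dist b c ≤ T.dist a c) (h2 : T.dist b c ≤ T.dist b e) :
    ∃ g ∈ UFplus T F ι, IsHyperbolic T g ∧ (g a = c ∧ g b = e) := by
  have k1 := dist_parity_adj T hT c a b hab
  rw [T.dist_comm (u := c) (v := a), T.dist_comm (u := c) (v := b)] at k1
  have k2 := dist_parity_adj T hT b c e hce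
  obtain ⟨p, hp⟩ := hT.connected.exists_walk_length_eq_dist a c
  obtain ⟨g, hg, ga, gb⟩ := (edge_trans hd T hT ι F hprim hncyc p b e hab hce).1 (by omega)
  refine ⟨g, hg, ?_, ga, gb⟩
  have nf := no_fix T hT a b c e hab hce (by omega) (by omega) g ga gb
  obtain ⟨x, hx⟩ := Nat.sInf_mem (s := Set.range fun x : V => T.dist x (g x)) ⟨_, a, rfl⟩
  unfold IsHyperbolic transLen
  rw [← hx]
  exact hT.connected.pos_dist_of_ne (nf x).symm

end Helpers

/-- Let `F` be primitive but not cyclic of prime order.  Then (a)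
every hyperbolic element of `U(F)⁺` has even translation length, and (b) for every pair
of edges of `𝒯` at odd distance there is a hyperbolic element of `U(F)⁺` mapping one to
the other. -/
theorem even_translation_length_and_odd_distance_edges
    {V : Type} (T : SimpleGraph V) (d : ℕ) (hd : 3 ≤ d)
    (hT : T.IsTree) (hreg : Regular T d) (ι : LegalColoring T d)
    (F : Subgroup (Equiv.Perm (Fin d)))
    (hprim : PermPrimitive F) (hncyc : ¬ CyclicOfPrimeOrder F) :
    (∀ g ∈ UFplus T F ι, IsHyperbolic T g → Even (transLen T g)) ∧
    (∀ a b c e : V, T.Adj a b → T.Adj c e →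
      Odd (min (min (T.dist a c) (T.dist a e)) (min (T.dist b c) (T.dist b e))) →
      ∃ g ∈ UFplus T F ι, IsHyperbolic T g ∧
        ((g a = c ∧ g b = e) ∨ (g a = e ∧ g b = c))) := by
  refine ⟨?_, ?_⟩
  · intro g hg _
    obtain ⟨y⟩ := hT.connected.nonempty
    obtain ⟨x, hx⟩ := Nat.sInf_mem (s := Set.range fun x : V => T.dist x (g x)) ⟨_, y, rfl⟩
    unfold transLen
    rw [← hx]
    exact Nat.even_iff.mpr (UFplus_even T hT F ι g hg x)
  · intro a b c e hab hce hodd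
    rw [Nat.odd_iff] at hodd
    have main := exists_hyp hd T hT ι F hprim hncyc
    by_cases hbc : T.dist b c ≤ T.dist a c ∧ T.dist b c ≤ T.dist b e ∧ T.dist b c ≤ T.dist a e
    · obtain ⟨g, hg, hh, h1, h2⟩ := main a b c e hab hce (by omega) (by omega) (by omega)
      exact ⟨g, hg, hh, Or.inl ⟨h1, h2⟩⟩
    by_cases hac : T.dist a c ≤ T.dist b c ∧ T.dist a c ≤ T.dist b e ∧ T.dist a c ≤ T.dist a e
    · obtain ⟨g, hg, hh, h1, h2⟩ := main b a c e hab.symm hce (by omega) (by omega) (by omega)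
      exact ⟨g, hg, hh, Or.inr ⟨h2, h1⟩⟩
    by_cases hbe : T.dist b e ≤ T.dist b c ∧ T.dist b e ≤ T.dist a c ∧ T.dist b e ≤ T.dist a e
    · obtain ⟨g, hg, hh, h1, h2⟩ := main a b e c hab hce.symm (by omega) (by omega) (by omega)
      exact ⟨g, hg, hh, Or.inr ⟨h1, h2⟩⟩
    obtain ⟨g, hg, hh, h1, h2⟩ := main b a e c hab.symm hce.symm (by omega) (by omega) (by omega)
    exact ⟨g, hg, hh, Or.inl ⟨h2, h1⟩⟩

end TreeHM
end
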